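/- arXiv:1307.8387 — 3 statements merged into one kernel-verified Lean document; each statement's English description precedes it below -/
import Mathlib

section
/- Let Γ be a finite simple graph such that the right-angled Artin group A(Γ) is non-abelian. Then for every natural number N there exist a finite-index subgroup A' of A(Γ) and a finite simple graph Γ' with at least N vertices such that A' is isomorphic to the right-angled Artin group A(Γ'). -/
/-- The defining relators of the right-angled Artin group on the simple graph `Γ`:
one commutator relator for each edge of `Γ`. -/
def raagRels {V : Type*} (Γ : SimpleGraph V) : Set (FreeGroup V) :=
  {r : FreeGroup V | ∃ u w : V, Γ.Adj u w ∧
    r = FreeGroup.of u * FreeGroup.of w * (FreeGroup.of u)⁻¹ * (FreeGroup.of w)⁻¹}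

/-- The right-angled Artin group of a simple graph `Γ`: the presented group with one
generator for each vertex of `Γ` and a commutator relator for each edge of `Γ`. -/
abbrev RAAG {V : Type*} (Γ : SimpleGraph V) : Type _ :=
  PresentedGroup (raagRels Γ)

namespace RAAGCover

section Generators

variable {V : Type*} (Γ : SimpleGraph V)

/-- The generator of the right-angled Artin group at a vertex. -/
def gen (a : V) : RAAG Γ := PresentedGroup.of a

variable {Γ}

theorem commute_gen {a b : V} (h : Γ.Adj a b) : Commute (gen Γ a) (gen Γ b) := by
  have h1 : (PresentedGroup.mk (raagRels Γ)) (FreeGroup.of a * FreeGroup.of b *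
      (FreeGroup.of a)⁻¹ * (FreeGroup.of b)⁻¹) = 1 :=
    PresentedGroup.one_of_mem ⟨a, b, h, rfl⟩
  simp only [map_mul, map_inv] at h1
  exact (mul_inv_eq_iff_eq_mul.mp (mul_inv_eq_one.mp h1))

/-- A map from the vertices to a group sending adjacent vertices to commuting elements extends
to the right-angled Artin group. -/
def lift {G : Type*} [Group G] (φ : V → G)
    (h : ∀ a b, Γ.Adj a b → Commute (φ a) (φ b)) : RAAG Γ →* G :=
  PresentedGroup.toGroup (f := φ) (rels := raagRels Γ) (by
    rintro r ⟨a, b, hab, rfl⟩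
    simp only [map_mul, map_inv, FreeGroup.lift_apply_of]
    rw [(h a b hab).eq]
    group)

@[simp]
theorem lift_gen {G : Type*} [Group G] (φ : V → G)
    (h : ∀ a b, Γ.Adj a b → Commute (φ a) (φ b)) (a : V) : lift φ h (gen Γ a) = φ a :=
  PresentedGroup.toGroup.of _

theorem mem_of_gen_mem (H : Subgroup (RAAG Γ)) (h : ∀ a, gen Γ a ∈ H) (x : RAAG Γ) : x ∈ H := by
  have h1 : Subgroup.closure (Set.range (PresentedGroup.of (rels := raagRels Γ))) ≤ H := by
    rw [Subgroup.closure_le]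
    rintro _ ⟨a, rfl⟩
    exact h a
  rw [PresentedGroup.closure_range_of] at h1
  exact h1 trivial

/-- A right-angled Artin group on a complete graph is abelian. -/
theorem exists_not_adj_of_nonabelian (hna : ∃ a b : RAAG Γ, a * b ≠ b * a) :
    ∃ u v : V, u ≠ v ∧ ¬ Γ.Adj v u := by
  by_contra! h
  obtain ⟨x, y, hxy⟩ := hna
  have hgen (a b : V) : Commute (gen Γ a) (gen Γ b) := by
    by_cases hab : b = a
    · rw [hab]
    · exact commute_gen (h b a hab)
  have h1 (a : V) (x : RAAG Γ) : x ∈ Subgroup.centralizer {gen Γ a} :=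
    mem_of_gen_mem _ (fun b => Subgroup.mem_centralizer_singleton_iff.mpr (hgen b a).eq) x
  have h2 : y ∈ Subgroup.centralizer {x} :=
    mem_of_gen_mem _ (fun b => Subgroup.mem_centralizer_singleton_iff.mpr
      (Subgroup.mem_centralizer_singleton_iff.mp (h1 b x)).symm) y
  exact hxy (Subgroup.mem_centralizer_singleton_iff.mp h2).symm

end Generators

section Cover

variable {V : Type*} (Γ : SimpleGraph V) (v : V) (m : ℕ)

/-- The vertices of the cyclic cover of degree `m + 1` along `v`: one copy of each vertex in the
star of `v`, and `m + 1` copies of every other vertex. -/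
abbrev CoverVertex : Type _ :=
  {p : V × Fin (m + 1) // p.2 = 0 ∨ (p.1 ≠ v ∧ ¬ Γ.Adj v p.1)}

/-- The graph whose right-angled Artin group is the kernel of the homomorphism to
`ℤ / (m + 1)` that sends `v` to `1` and the other generators to `0`. -/
def coverGraph : SimpleGraph (CoverVertex Γ v m) where
  Adj p q := Γ.Adj p.1.1 q.1.1 ∧ (p.1.2 = q.1.2 ∨ Γ.Adj v p.1.1 ∨ Γ.Adj v q.1.1)
  symm := ⟨fun p q h => ⟨h.1.symm, by
    rcases h.2 with h | h | h
    · exact Or.inl h.symm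
    · exact Or.inr (Or.inr h)
    · exact Or.inr (Or.inl h)⟩⟩
  loopless := ⟨fun p h => Γ.loopless.irrefl _ h.1⟩

open Classical in
/-- The copy of the vertex `a` lying on the sheet `i` of the cover. -/
noncomputable def sheet (a : V) (i : Fin (m + 1)) : CoverVertex Γ v m :=
  if h : a ≠ v ∧ ¬ Γ.Adj v a then ⟨(a, i), Or.inr h⟩ else ⟨(a, 0), Or.inl rfl⟩

variable {Γ v m}

theorem sheet_val (p : CoverVertex Γ v m) : sheet Γ v m p.1.1 p.1.2 = p := by
  obtain ⟨⟨a, i⟩, h⟩ := p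
  unfold sheet
  split_ifs with h1
  · rfl
  · have : i = 0 := h.resolve_right h1
    subst this
    rfl

theorem sheet_of_adj {a : V} (h : Γ.Adj v a) (i j : Fin (m + 1)) :
    sheet Γ v m a i = sheet Γ v m a j := by
  simp [sheet, h]

theorem sheet_self (i : Fin (m + 1)) : sheet Γ v m v i = ⟨(v, 0), Or.inl rfl⟩ := by
  simp [sheet]

theorem sheet_fst (a : V) (i : Fin (m + 1)) : (sheet Γ v m a i).1.1 = a := by
  unfold sheet
  split_ifs <;> rfl

theorem sheet_adj {a b : V} (h : Γ.Adj a b) (i : Fin (m + 1)) :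
    (coverGraph Γ v m).Adj (sheet Γ v m a i) (sheet Γ v m b i) := by
  refine ⟨by simpa only [sheet_fst] using h, ?_⟩
  simp only [sheet_fst]
  by_cases ha : Γ.Adj v a
  · exact Or.inr (Or.inl ha)
  by_cases hb : Γ.Adj v b
  · exact Or.inr (Or.inr hb)
  have hav : a ≠ v := fun e => hb (e ▸ h)
  have hbv : b ≠ v := fun e => ha (e ▸ h.symm)
  left
  simp [sheet, ha, hb, hav, hbv]

variable (Γ v m)

open Classical in
/-- The image in the right-angled Artin group of `Γ` of a generator of the cover. -/
noncomputable def coverImage (p : CoverVertex Γ v m) : RAAG Γ :=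
  if p.1.1 = v then gen Γ v ^ (m + 1)
  else (gen Γ v ^ (p.1.2 : ℕ))⁻¹ * gen Γ p.1.1 * gen Γ v ^ (p.1.2 : ℕ)

variable {Γ v m}

theorem coverImage_of_adj {p : CoverVertex Γ v m} (h : Γ.Adj v p.1.1) (k : ℕ) :
    coverImage Γ v m p = (gen Γ v ^ k)⁻¹ * gen Γ p.1.1 * gen Γ v ^ k := by
  have hc (k : ℕ) : (gen Γ v ^ k)⁻¹ * gen Γ p.1.1 * gen Γ v ^ k = gen Γ p.1.1 := by
    rw [mul_assoc, ((commute_gen h).pow_left k).symm.eq, inv_mul_cancel_left]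
  rw [coverImage, if_neg h.ne', hc, hc]

theorem commute_conj_gen {a b : V} (h : Γ.Adj a b) (x : RAAG Γ) :
    Commute (x⁻¹ * gen Γ a * x) (x⁻¹ * gen Γ b * x) := by
  simpa using (Commute.conj_iff x⁻¹).mpr (commute_gen h)

theorem commute_coverImage {p q : CoverVertex Γ v m} (h : (coverGraph Γ v m).Adj p q) :
    Commute (coverImage Γ v m p) (coverImage Γ v m q) := by
  obtain ⟨h, h1⟩ := h
  have key {p q : CoverVertex Γ v m} (h : Γ.Adj p.1.1 q.1.1) (hp : Γ.Adj v p.1.1) :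
      Commute (coverImage Γ v m p) (coverImage Γ v m q) := by
    by_cases hq : q.1.1 = v
    · rw [coverImage_of_adj hp 0, coverImage, if_pos hq]
      simpa using ((commute_gen hp).pow_left (m + 1)).symm
    · rw [coverImage_of_adj hp q.1.2, coverImage, if_neg hq]
      exact commute_conj_gen h _
  by_cases hp : Γ.Adj v p.1.1
  · exact key h hp
  by_cases hq : Γ.Adj v q.1.1
  · exact (key h.symm hq).symm
  have h2 : p.1.2 = q.1.2 := by tauto
  have hpv : p.1.1 ≠ v := fun e => hq (by rwa [e] at h)
  have hqv : q.1.1 ≠ v := fun e => hp (by rw [e] at h; exact h.symm)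
  rw [coverImage, coverImage, if_neg hpv, if_neg hqv, h2]
  exact commute_conj_gen h _

variable (Γ v m)

/-- The homomorphism from the right-angled Artin group of the cover to that of `Γ`. -/
noncomputable def coverHom : RAAG (coverGraph Γ v m) →* RAAG Γ :=
  lift (coverImage Γ v m) fun _ _ => commute_coverImage

open Classical in
/-- The permutation by which a generator of the right-angled Artin group of `Γ` acts on the
disjoint union of `m + 1` copies of the right-angled Artin group of the cover. -/
noncomputable def genPerm (a : V) : Equiv.Perm (Fin (m + 1) × RAAG (coverGraph Γ v m)) :=
  if a = v then
    Equiv.prodShear (Equiv.addRight 1) fun i =>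
      Equiv.mulLeft (if i = Fin.last m then gen _ (sheet Γ v m v 0) else 1)
  else Equiv.prodShear (Equiv.refl _) fun i => Equiv.mulLeft (gen _ (sheet Γ v m a i))

variable {Γ v m}

theorem genPerm_self (i : Fin (m + 1)) (g : RAAG (coverGraph Γ v m)) :
    genPerm Γ v m v (i, g) =
      (i + 1, (if i = Fin.last m then gen _ (sheet Γ v m v 0) else 1) * g) := by
  simp [genPerm]

theorem genPerm_of_ne {a : V} (h : a ≠ v) (i : Fin (m + 1)) (g : RAAG (coverGraph Γ v m)) :
    genPerm Γ v m a (i, g) = (i, gen _ (sheet Γ v m a i) * g) := by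
  simp [genPerm, h]

theorem commute_genPerm {a b : V} (h : Γ.Adj a b) :
    Commute (genPerm Γ v m a) (genPerm Γ v m b) := by
  have key {b : V} (h : Γ.Adj v b) : Commute (genPerm Γ v m v) (genPerm Γ v m b) := by
    refine Equiv.ext fun ⟨i, g⟩ => ?_
    simp only [Equiv.Perm.mul_apply, genPerm_self, genPerm_of_ne h.ne']
    rw [sheet_of_adj h (i + 1) 0, sheet_of_adj h i 0]
    split_ifs
    · rw [← mul_assoc, ← mul_assoc, (commute_gen (sheet_adj h 0)).eq]
    · simp
  by_cases ha : a = v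
  · subst ha
    exact key h
  by_cases hb : b = v
  · subst hb
    exact (key h.symm).symm
  refine Equiv.ext fun ⟨i, g⟩ => ?_
  simp only [Equiv.Perm.mul_apply, genPerm_of_ne ha, genPerm_of_ne hb]
  rw [← mul_assoc, ← mul_assoc, (commute_gen (sheet_adj h i)).eq]

variable (Γ v m)

/-- The action of the right-angled Artin group of `Γ` on `m + 1` copies of the right-angled
Artin group of the cover. -/
noncomputable def permHom : RAAG Γ →* Equiv.Perm (Fin (m + 1) × RAAG (coverGraph Γ v m)) :=
  lift (genPerm Γ v m) fun _ _ => commute_genPerm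

variable {Γ v m}

theorem permHom_gen_pow (k : ℕ) (hk : k < m + 1) (g : RAAG (coverGraph Γ v m)) :
    permHom Γ v m (gen Γ v ^ k) (0, g) = (⟨k, hk⟩, g) := by
  induction k with
  | zero => simp
  | succ k ih =>
    rw [pow_succ', map_mul, Equiv.Perm.mul_apply, ih (by omega), permHom, lift_gen,
      genPerm_self, if_neg (by simp [Fin.ext_iff]; omega), one_mul]
    congr 1
    exact Fin.ext (Fin.val_add_one_of_lt (by simp [Fin.lt_def]; omega))

theorem permHom_coverHom (x g : RAAG (coverGraph Γ v m)) :
    permHom Γ v m (coverHom Γ v m x) (0, g) = (0, x * g) := by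
  let H : Subgroup (RAAG (coverGraph Γ v m)) :=
    { carrier := {x | ∀ g, permHom Γ v m (coverHom Γ v m x) (0, g) = (0, x * g)}
      one_mem' := fun g => by simp
      mul_mem' := fun {x y} hx hy g => by
        rw [map_mul, map_mul, Equiv.Perm.mul_apply, hy, hx, mul_assoc]
      inv_mem' := fun {x} hx g => by
        rw [map_inv, map_inv, Equiv.Perm.inv_eq_iff_eq, hx, mul_inv_cancel_left] }
  refine mem_of_gen_mem H (fun p g => ?_) x g
  rw [coverHom, lift_gen, coverImage]
  split_ifs with hp
  · rw [pow_succ', map_mul, Equiv.Perm.mul_apply, permHom_gen_pow m (by omega), permHom,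
      lift_gen, genPerm_self, if_pos (by rfl)]
    have h1 := sheet_val p
    rw [hp, sheet_self] at h1
    rw [sheet_self, h1]
    congr 1
    exact Fin.last_add_one m
  · rw [map_mul, map_mul, map_inv, Equiv.Perm.mul_apply, Equiv.Perm.mul_apply,
      Equiv.Perm.inv_eq_iff_eq, permHom_gen_pow _ p.1.2.2, permHom_gen_pow _ p.1.2.2]
    rw [permHom, lift_gen, genPerm_of_ne hp, Fin.eta, sheet_val]

theorem coverHom_injective : Function.Injective (coverHom Γ v m) := by
  intro x y h
  simpa [permHom_coverHom] using
    congrArg (fun z => permHom Γ v m z (0, (1 : RAAG (coverGraph Γ v m)))) h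

theorem coverHom_sheet_of_ne {a : V} (h : a ≠ v) (i : Fin (m + 1)) :
    coverHom Γ v m (gen _ (sheet Γ v m a i)) =
      (gen Γ v ^ (i : ℕ))⁻¹ * gen Γ a * gen Γ v ^ (i : ℕ) := by
  rw [coverHom, lift_gen]
  by_cases ha : Γ.Adj v a
  · rw [coverImage_of_adj (by rwa [sheet_fst]) i, sheet_fst]
  · simp [coverImage, sheet, h, ha]

theorem pow_mul_coverHom_permHom (x : RAAG Γ) (p : Fin (m + 1) × RAAG (coverGraph Γ v m)) :
    gen Γ v ^ ((permHom Γ v m x p).1 : ℕ) * coverHom Γ v m (permHom Γ v m x p).2 =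
      x * (gen Γ v ^ (p.1 : ℕ) * coverHom Γ v m p.2) := by
  let Φ (p : Fin (m + 1) × RAAG (coverGraph Γ v m)) : RAAG Γ :=
    gen Γ v ^ (p.1 : ℕ) * coverHom Γ v m p.2
  let H : Subgroup (RAAG Γ) :=
    { carrier := {x | ∀ p, Φ (permHom Γ v m x p) = x * Φ p}
      one_mem' := fun p => by simp
      mul_mem' := fun {x y} hx hy p => by
        rw [map_mul, Equiv.Perm.mul_apply, hx, hy, mul_assoc]
      inv_mem' := fun {x} hx p => by
        rw [eq_inv_mul_iff_mul_eq, ← hx, ← Equiv.Perm.mul_apply, ← map_mul, mul_inv_cancel, map_one,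
            Equiv.Perm.one_apply] }
  refine mem_of_gen_mem H (fun a => ?_) x p
  rintro ⟨i, g⟩
  rw [permHom, lift_gen]
  by_cases ha : a = v
  · subst ha
    rw [genPerm_self]
    simp only [Φ]
    split_ifs with hi
    · subst hi
      rw [map_mul, coverHom, lift_gen, coverImage, if_pos (sheet_fst _ _)]
      simp [pow_succ', mul_assoc]
    · rw [Fin.val_add_one_of_lt (lt_of_le_of_ne (Fin.le_last i) hi)]
      simp [pow_succ', mul_assoc]
  · rw [genPerm_of_ne ha]
    simp only [Φ]
    rw [map_mul, coverHom_sheet_of_ne ha]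
    group

theorem finiteIndex_range_coverHom : (coverHom Γ v m).range.FiniteIndex := by
  have hsurj : Function.Surjective fun i : Fin (m + 1) =>
      (QuotientGroup.mk (gen Γ v ^ (i : ℕ)) : RAAG Γ ⧸ (coverHom Γ v m).range) := by
    intro q
    induction q using QuotientGroup.induction_on with
    | H x =>
      have h := pow_mul_coverHom_permHom x ((0, 1) : Fin (m + 1) × RAAG (coverGraph Γ v m))
      simp only [Fin.val_zero, pow_zero, map_one, mul_one] at h
      refine ⟨(permHom Γ v m x (0, 1)).1, QuotientGroup.eq.mpr ?_⟩
      nth_rewrite 2 [← h]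
      rw [inv_mul_cancel_left]
      exact ⟨_, rfl⟩
  have := Finite.of_surjective _ hsurj
  exact Subgroup.finiteIndex_of_finite_quotient

end Cover

end RAAGCover

/-- A non-abelian right-angled Artin group has finite-index subgroups that are
right-angled Artin groups on graphs with arbitrarily many vertices. -/
theorem raag_finite_index_subgroup_raag_many_vertices
    {V : Type} [Fintype V] (Γ : SimpleGraph V)
    (hna : ∃ a b : RAAG Γ, a * b ≠ b * a) (N : ℕ) :
    ∃ A' : Subgroup (RAAG Γ), A'.FiniteIndex ∧
      ∃ (V' : Type) (_ : Fintype V') (Γ' : SimpleGraph V'),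
        N ≤ Fintype.card V' ∧ Nonempty (A' ≃* RAAG Γ') := by
  classical
  obtain ⟨u, v, huv, hadj⟩ := RAAGCover.exists_not_adj_of_nonabelian hna
  refine ⟨(RAAGCover.coverHom Γ v N).range, RAAGCover.finiteIndex_range_coverHom,
    RAAGCover.CoverVertex Γ v N, Fintype.ofFinite _, RAAGCover.coverGraph Γ v N, ?_,
    ⟨(MonoidHom.ofInjective RAAGCover.coverHom_injective).symm⟩⟩
  let e : Fin (N + 1) → RAAGCover.CoverVertex Γ v N := fun i => ⟨(u, i), Or.inr ⟨huv, hadj⟩⟩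
  have he : Function.Injective e := fun i j h => congrArg (fun p => p.1.2) h
  have hcard := @Fintype.card_le_of_injective _ _ _ (Fintype.ofFinite _) e he
  rw [Fintype.card_fin] at hcard
  omega
end

section
/- Let n ≥ 3. The group GL_n(ℤ) of invertible n×n integer matrices is not abstractly commensurable with the right-angled Artin group A(Γ) of any finite simple graph Γ. -/
/-- Two groups are abstractly commensurable if they have isomorphic finite-index
subgroups. -/
def AbstractlyCommensurable (G H : Type*) [Group G] [Group H] : Prop :=
  ∃ (G' : Subgroup G) (H' : Subgroup H),
    G'.FiniteIndex ∧ H'.FiniteIndex ∧ Nonempty (G' ≃* H')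

/-- Every relation `x * y = z * (y * x)` with `z` commuting with both `x` and `y` is trivial. For a
torsion-free group this says that it has no subgroup isomorphic to the integral Heisenberg group. -/
def HeisenbergFree (G : Type*) [Group G] : Prop :=
  ∀ x y z : G, x * y = z * (y * x) → Commute x z → Commute y z → z = 1

theorem HeisenbergFree.of_injective {G H : Type*} [Group G] [Group H] (hH : HeisenbergFree H)
    (f : G →* H) (hf : Function.Injective f) : HeisenbergFree G := by
  intro x y z h hx hy
  apply hf
  rw [map_one]
  refine hH (f x) (f y) (f z) ?_ (hx.map f) (hy.map f)
  rw [← map_mul, h, map_mul, map_mul]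

theorem mul_pow_eq_of_mul_eq {G : Type*} [Group G] {x y z : G} (h : x * y = z * (y * x))
    (hy : Commute y z) (k : ℕ) : x * y ^ k = z ^ k * (y ^ k * x) := by
  induction k with
  | zero => simp
  | succ k ih =>
    calc x * y ^ (k + 1) = x * y ^ k * y := by rw [pow_succ, mul_assoc]
      _ = z ^ k * y ^ k * (x * y) := by rw [ih]; group
      _ = z ^ k * (y ^ k * z) * (y * x) := by rw [h]; group
      _ = z ^ k * (z * y ^ k) * (y * x) := by rw [(hy.pow_left k).eq]
      _ = z ^ (k + 1) * (y ^ (k + 1) * x) := by group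

theorem pow_mul_pow_eq_of_mul_eq {G : Type*} [Group G] {x y z : G} (h : x * y = z * (y * x))
    (hx : Commute x z) (hy : Commute y z) (m k : ℕ) :
    x ^ m * y ^ k = z ^ (m * k) * (y ^ k * x ^ m) := by
  induction m with
  | zero => simp
  | succ m ih =>
    calc x ^ (m + 1) * y ^ k = x ^ m * (x * y ^ k) := by rw [pow_succ, mul_assoc]
      _ = x ^ m * z ^ k * (y ^ k * x) := by rw [mul_pow_eq_of_mul_eq h hy, mul_assoc]
      _ = z ^ k * (x ^ m * y ^ k) * x := by rw [(hx.pow_pow m k).eq]; group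
      _ = z ^ k * z ^ (m * k) * (y ^ k * (x ^ m * x)) := by rw [ih]; group
      _ = z ^ ((m + 1) * k) * (y ^ k * x ^ (m + 1)) := by
        rw [← pow_add, ← pow_succ, Nat.succ_mul, Nat.add_comm]

namespace FreeGroup

theorem le_norm_pow {α : Type*} [DecidableEq α] {w : FreeGroup α} (hw : w ≠ 1) (k : ℕ) :
    k ≤ (w ^ k).norm := by
  rcases Nat.eq_zero_or_pos k with rfl | hk
  · simp
  have hne : reduceCyclically w.toWord ≠ [] := by
    intro h
    have hc := reduceCyclically.conj_conjugator_reduceCyclically w.toWord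
    rw [h, List.append_nil] at hc
    apply hw
    rw [← mk_toWord (x := w), ← hc, ← mul_mk, ← inv_mk, mul_inv_cancel]
  have hlen : 1 ≤ (reduceCyclically w.toWord).length := List.length_pos_iff.2 hne
  have hmul := Nat.mul_le_mul_left k hlen
  rw [norm, toWord_pow, reduceCyclically.reduce_flatten_replicate isReduced_toWord,
    if_neg hk.ne']
  simp only [List.length_append, List.length_flatten, List.map_replicate, List.sum_replicate,
    smul_eq_mul]
  omega

theorem norm_map_le {α β : Type*} [DecidableEq α] [DecidableEq β] (f : α → β)
    (w : FreeGroup α) : (map f w).norm ≤ w.norm := by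
  conv_lhs => rw [← mk_toWord (x := w), map.mk]
  exact norm_mk_le.trans (by simp [norm])

/-- A group acting on a type acts by automorphisms on the free group on that type. -/
def permAut (A S : Type*) [Group A] [MulAction A S] : A →* MulAut (FreeGroup S) where
  toFun a := freeGroupCongr (MulAction.toPerm a)
  map_one' := by
    ext w
    induction w using FreeGroup.induction_on <;> simp_all
  map_mul' a b := by
    ext w
    induction w using FreeGroup.induction_on <;> simp_all [mul_smul]

theorem permAut_apply {A S : Type*} [Group A] [MulAction A S] (a : A) (w : FreeGroup S) :
    permAut A S a w = map (fun s => a • s) w := rfl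

end FreeGroup

open FreeGroup in
theorem HeisenbergFree.semidirectProduct {A S : Type*} [Group A] [MulAction A S]
    (hA : HeisenbergFree A) : HeisenbergFree (FreeGroup S ⋊[permAut A S] A) := by
  classical
  intro x y z h hx hy
  have norm_mul (g g' : FreeGroup S ⋊[permAut A S] A) :
      (g * g').left.norm ≤ g.left.norm + g'.left.norm := by
    rw [SemidirectProduct.mul_left]
    exact (FreeGroup.norm_mul_le _ _).trans (Nat.add_le_add_left (norm_map_le _ _) _)
  have norm_inv (g : FreeGroup S ⋊[permAut A S] A) : g⁻¹.left.norm ≤ g.left.norm := by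
    rw [SemidirectProduct.inv_left]
    exact (norm_map_le _ _).trans norm_inv_eq.le
  have norm_pow (g : FreeGroup S ⋊[permAut A S] A) (m : ℕ) :
      (g ^ m).left.norm ≤ m * g.left.norm := by
    induction m with
    | zero => simp
    | succ m ih =>
      rw [pow_succ, Nat.succ_mul]
      exact (norm_mul _ _).trans (Nat.add_le_add_right ih _)
  have hr : z.right = 1 := by
    refine hA x.right y.right z.right ?_ (hx.map SemidirectProduct.rightHom)
      (hy.map SemidirectProduct.rightHom)
    simpa using congrArg SemidirectProduct.right h
  have hz : z = SemidirectProduct.inl z.left := by ext <;> simp [hr]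
  by_contra hz1
  have hw : z.left ≠ 1 := fun hw => hz1 (by rw [hz, hw, _root_.map_one])
  have key (m : ℕ) : m * m ≤ 2 * m * (x.left.norm + y.left.norm) := by
    have hpow : z ^ (m * m) = x ^ m * y ^ m * (y ^ m * x ^ m)⁻¹ := by
      rw [pow_mul_pow_eq_of_mul_eq h hx hy, mul_inv_cancel_right]
    have hleft : (z ^ (m * m)).left = z.left ^ (m * m) := by
      rw [hz, ← map_pow, SemidirectProduct.left_inl, SemidirectProduct.left_inl]
    have h₁ := le_norm_pow hw (m * m)
    rw [← hleft, hpow] at h₁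
    have h₂ := norm_mul (x ^ m * y ^ m) (y ^ m * x ^ m)⁻¹
    have h₃ := norm_inv (y ^ m * x ^ m)
    have h₄ := norm_mul (x ^ m) (y ^ m)
    have h₅ := norm_mul (y ^ m) (x ^ m)
    have h₆ := norm_pow x m
    have h₇ := norm_pow y m
    linarith
  have := key (2 * (x.left.norm + y.left.norm) + 1)
  nlinarith

namespace RAAG

variable {V W G : Type*} [Group G] {Γ : SimpleGraph V}

theorem commute_of {u w : V} (h : Γ.Adj u w) :
    Commute (PresentedGroup.of u : RAAG Γ) (PresentedGroup.of w) := by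
  have hr : PresentedGroup.mk (raagRels Γ) _ = 1 :=
    PresentedGroup.one_of_mem (rels := raagRels Γ) ⟨u, w, h, rfl⟩
  rw [← commutatorElement_eq_one_iff_commute]
  exact hr

/-- The universal property of right-angled Artin groups. -/
def lift (f : V → G) (hf : ∀ u w, Γ.Adj u w → Commute (f u) (f w)) : RAAG Γ →* G :=
  PresentedGroup.toGroup (f := f) (by
    rintro _ ⟨u, w, h, rfl⟩
    simpa [commutatorElement_def] using commutatorElement_eq_one_iff_commute.2 (hf u w h))

@[simp]
theorem lift_of (f : V → G) (hf : ∀ u w, Γ.Adj u w → Commute (f u) (f w)) (v : V) :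
    lift f hf (PresentedGroup.of v) = f v :=
  PresentedGroup.toGroup.of _

theorem injective_of_comp_eq {H : Type*} [Group H] (f : RAAG Γ →* H) (g : H →* RAAG Γ)
    (h : ∀ v, g (f (PresentedGroup.of v)) = PresentedGroup.of v) : Function.Injective f := by
  have hgf : g.comp f = MonoidHom.id _ := PresentedGroup.ext h
  exact Function.LeftInverse.injective (g := g) (DFunLike.congr_fun hgf)

/-- The inclusion of the right-angled Artin group of an induced subgraph. -/
def mapComap (f : W → V) (Γ : SimpleGraph V) : RAAG (Γ.comap f) →* RAAG Γ :=
  lift (fun w => PresentedGroup.of (f w)) fun _ _ h => commute_of h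

@[simp]
theorem mapComap_of (f : W → V) (Γ : SimpleGraph V) (w : W) :
    mapComap f Γ (PresentedGroup.of w) = PresentedGroup.of (f w) :=
  lift_of _ _ _

/-- The subgroup generated by the link of the vertex `none`. -/
def link (Γ : SimpleGraph (Option V)) : Subgroup (RAAG (Γ.comap some)) :=
  Subgroup.closure (PresentedGroup.of '' {v | Γ.Adj none (some v)})

theorem commute_mapComap_of_mem_link {Γ : SimpleGraph (Option V)} {c : RAAG (Γ.comap some)}
    (hc : c ∈ link Γ) : Commute (mapComap some Γ c) (PresentedGroup.of none) := by
  induction hc using Subgroup.closure_induction with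
  | mem c hc =>
    obtain ⟨v, hv, rfl⟩ := hc
    rw [mapComap_of]
    exact (commute_of hv).symm
  | one => simp
  | mul a b _ _ ha hb => simpa using ha.mul_left hb
  | inv a _ ha => simpa using ha.inv_left

open FreeGroup (permAut permAut_apply)

/-- The right-angled Artin group of `Γ` maps to the semidirect product of the group of the graph
without `none` with the free group on the cosets of the link of `none`, which is generated by the
conjugates of `none`. -/
def toSemidirect (Γ : SimpleGraph (Option V)) :
    RAAG Γ →* FreeGroup (RAAG (Γ.comap some) ⧸ link Γ) ⋊[permAut (RAAG (Γ.comap some)) _]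
      RAAG (Γ.comap some) :=
  have key (v : V) (h : Γ.Adj none (some v)) :
      Commute (SemidirectProduct.inr (PresentedGroup.of v) :
        FreeGroup (RAAG (Γ.comap some) ⧸ link Γ) ⋊[permAut (RAAG (Γ.comap some)) _]
          RAAG (Γ.comap some))
        (SemidirectProduct.inl (FreeGroup.of (QuotientGroup.mk 1))) := by
    have hv : (PresentedGroup.of v : RAAG (Γ.comap some)) ∈ link Γ :=
      Subgroup.subset_closure ⟨v, h, rfl⟩
    have hq : (PresentedGroup.of v : RAAG (Γ.comap some)) •
        (QuotientGroup.mk 1 : RAAG (Γ.comap some) ⧸ link Γ) = QuotientGroup.mk 1 := by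
      rw [MulAction.Quotient.smul_mk, smul_eq_mul, mul_one, QuotientGroup.eq, mul_one]
      exact inv_mem hv
    have haut := SemidirectProduct.inl_aut (φ := permAut (RAAG (Γ.comap some))
      (RAAG (Γ.comap some) ⧸ link Γ)) (PresentedGroup.of v) (FreeGroup.of (QuotientGroup.mk 1))
    rw [permAut_apply, FreeGroup.map.of, hq, map_inv, eq_mul_inv_iff_mul_eq] at haut
    exact haut.symm
  lift (fun o => o.elim (SemidirectProduct.inl (FreeGroup.of (QuotientGroup.mk 1)))
      fun v => SemidirectProduct.inr (PresentedGroup.of v)) (by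
    rintro (_ | u) (_ | w) h
    · exact (Γ.irrefl h).elim
    · exact (key w h).symm
    · exact key u h.symm
    · exact (commute_of (Γ := Γ.comap some) h).map SemidirectProduct.inr)

/-- The map from the semidirect product back to the right-angled Artin group of `Γ`, sending the
coset of `a` to the conjugate of `none` by `a`. -/
def ofSemidirect (Γ : SimpleGraph (Option V)) :
    FreeGroup (RAAG (Γ.comap some) ⧸ link Γ) ⋊[permAut (RAAG (Γ.comap some)) _]
      RAAG (Γ.comap some) →* RAAG Γ :=
  SemidirectProduct.lift
    (FreeGroup.lift fun q => Quotient.liftOn' q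
      (fun a => mapComap some Γ a * PresentedGroup.of none * (mapComap some Γ a)⁻¹) (by
        intro a b hab
        rw [QuotientGroup.leftRel_apply] at hab
        obtain ⟨c, hc, rfl⟩ : ∃ c ∈ link Γ, b = a * c := ⟨a⁻¹ * b, hab, by group⟩
        have := (commute_mapComap_of_mem_link hc).eq
        simp only [map_mul, mul_inv_rev]
        rw [mul_assoc (mapComap some Γ a) (mapComap some Γ c), this]
        group))
    (mapComap some Γ)
    (by
      intro a
      ext q
      induction q using Quotient.inductionOn'
      simp only [MonoidHom.comp_apply, MulEquiv.coe_toMonoidHom, permAut_apply, FreeGroup.map.of,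
        FreeGroup.lift_apply_of, MulAut.conj_apply]
      change mapComap some Γ (a * _) * _ * (mapComap some Γ (a * _))⁻¹ =
        mapComap some Γ a * (mapComap some Γ _ * _ * (mapComap some Γ _)⁻¹) * _
      simp only [map_mul, mul_inv_rev]
      group)

theorem toSemidirect_injective (Γ : SimpleGraph (Option V)) :
    Function.Injective (toSemidirect Γ) := by
  refine injective_of_comp_eq _ (ofSemidirect Γ) ?_
  rintro (_ | v)
  · rw [toSemidirect, lift_of, Option.elim_none, ofSemidirect, SemidirectProduct.lift_inl,
      FreeGroup.lift_apply_of]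
    change mapComap some Γ 1 * _ * (mapComap some Γ 1)⁻¹ = _
    simp
  · rw [toSemidirect, lift_of, Option.elim_some, ofSemidirect, SemidirectProduct.lift_inr,
      mapComap_of]

theorem heisenbergFree {V : Type*} [Finite V] (Γ : SimpleGraph V) : HeisenbergFree (RAAG Γ) := by
  induction V using Finite.induction_empty_option with
  | of_equiv e ih =>
    refine (ih (Γ.comap e)).of_injective
      (lift (fun v => PresentedGroup.of (e.symm v)) fun u w h => commute_of (by simpa using h))
      (injective_of_comp_eq _ (mapComap e Γ) fun v => ?_)
    rw [lift_of, mapComap_of, e.apply_symm_apply]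
  | h_empty =>
    intro x y z _ _ _
    have hid : MonoidHom.id (RAAG Γ) = 1 := PresentedGroup.ext fun v => v.elim
    exact DFunLike.congr_fun hid z
  | h_option ih =>
    exact (ih (Γ.comap some)).semidirectProduct.of_injective _ (toSemidirect_injective Γ)

end RAAG

namespace Matrix

variable {ι R : Type*} [Fintype ι] [DecidableEq ι] [CommRing R]

/-- A transvection as an element of the general linear group. -/
def transvectionGL {i j : ι} (h : i ≠ j) (c : R) : GL ι R where
  val := transvection i j c
  inv := transvection i j (-c)
  val_inv := by simp [transvection_mul_transvection_same _ _ h]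
  inv_val := by simp [transvection_mul_transvection_same _ _ h]

theorem transvectionGL_pow {i j : ι} (h : i ≠ j) (c : R) (k : ℕ) :
    transvectionGL h c ^ k = transvectionGL h (k * c) := by
  induction k with
  | zero => ext1; simp [transvectionGL]
  | succ k ih =>
    rw [pow_succ, ih]
    ext1
    simp [transvectionGL, transvection_mul_transvection_same _ _ h, add_mul]

theorem transvectionGL_mul {i j k : ι} (hij : i ≠ j) (hjk : j ≠ k) (hik : i ≠ k) (a b : R) :
    transvectionGL hij a * transvectionGL hjk b =
      transvectionGL hik (a * b) * (transvectionGL hjk b * transvectionGL hij a) := by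
  ext1
  simp [transvectionGL, transvection, mul_add, add_mul, hjk.symm, hik.symm]
  abel

theorem commute_transvectionGL {i j k l : ι} (hij : i ≠ j) (hkl : k ≠ l) (hjk : j ≠ k)
    (hil : i ≠ l) (a b : R) : Commute (transvectionGL hij a) (transvectionGL hkl b) := by
  ext1
  simp [transvectionGL, transvection, mul_add, add_mul, hjk, hil.symm]
  abel

theorem transvectionGL_ne_one {i j : ι} (h : i ≠ j) {c : R} (hc : c ≠ 0) :
    transvectionGL h c ≠ 1 := by
  intro h1
  apply hc
  simpa [transvectionGL, transvection, h] using congrArg (fun g : GL ι R => g.val i j) h1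

end Matrix

open Matrix in
theorem not_heisenbergFree_of_finiteIndex {n : ℕ} (hn : 3 ≤ n) (G : Subgroup (GL (Fin n) ℤ))
    [G.FiniteIndex] : ¬ HeisenbergFree G := by
  intro hG
  have h01 : (⟨0, by omega⟩ : Fin n) ≠ ⟨1, by omega⟩ := by simp
  have h12 : (⟨1, by omega⟩ : Fin n) ≠ ⟨2, by omega⟩ := by simp
  have h02 : (⟨0, by omega⟩ : Fin n) ≠ ⟨2, by omega⟩ := by simp
  have hpow {i j : Fin n} (h : i ≠ j) : ∃ a : ℤ, a ≠ 0 ∧ transvectionGL h a ∈ G := by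
    obtain ⟨k, hk, -, hmem⟩ := G.exists_pow_mem_of_index_ne_zero
      Subgroup.FiniteIndex.index_ne_zero (transvectionGL h (1 : ℤ))
    rw [transvectionGL_pow, mul_one] at hmem
    exact ⟨k, by exact_mod_cast hk.ne', hmem⟩
  obtain ⟨a, ha, hx⟩ := hpow h01
  obtain ⟨b, hb, hy⟩ := hpow h12
  have hmul := transvectionGL_mul h01 h12 h02 a b
  have hz : transvectionGL h02 (a * b) ∈ G := by
    rw [← mul_inv_eq_iff_eq_mul.2 hmul]
    exact mul_mem (mul_mem hx hy) (inv_mem (mul_mem hy hx))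
  have hone := hG ⟨_, hx⟩ ⟨_, hy⟩ ⟨_, hz⟩ (Subtype.ext hmul)
    (Subtype.ext (commute_transvectionGL h01 h02 h01.symm h02 a (a * b)))
    (Subtype.ext (commute_transvectionGL h12 h02 h02.symm h12 b (a * b)))
  exact transvectionGL_ne_one h02 (mul_ne_zero ha hb) (congrArg Subtype.val hone)

/-- For `n ≥ 3`, the group `GL n ℤ` is not abstractly commensurable with any
right-angled Artin group. -/
theorem glnz_not_commensurable_raag (n : ℕ) (hn : 3 ≤ n) :
    ∀ {V : Type} [Fintype V] (Γ : SimpleGraph V),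
      ¬ AbstractlyCommensurable (GL (Fin n) ℤ) (RAAG Γ) := by
  rintro V _ Γ ⟨G, H, hG, -, ⟨e⟩⟩
  exact not_heisenbergFree_of_finiteIndex hn G
    ((RAAG.heisenbergFree Γ).of_injective (H.subtype.comp e.toMonoidHom)
      (H.subtype_injective.comp e.injective))
end

section
/- Let n and k be natural numbers. If there exists an injective group homomorphism from (ℤ/2ℤ)^k into GL_n(ℂ), then k ≤ n. -/
open Module in
/-- An endomorphism with square one is semisimple when `2` is invertible. -/
theorem Module.End.isSemisimple_of_sq_eq_one {K V : Type*} [Field K] [NeZero (2 : K)]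
    [AddCommGroup V] [Module K V] {f : End K V} (hf : f ^ 2 = 1) : f.IsSemisimple := by
  refine isSemisimple_of_squarefree_aeval_eq_zero (p := Polynomial.X ^ 2 - 1)
    (Polynomial.X_pow_sub_one_separable_iff.2 ?_).squarefree (by simp [hf])
  simpa using NeZero.ne (2 : K)

open Module in
/-- An injective family of pairwise commuting involutions of a finite-dimensional vector space
`V` has at most `2 ^ dim V` members. -/
theorem Module.End.card_le_two_pow_finrank_of_commute_of_sq_eq_one {K V ι : Type*} [Field K]
    [IsAlgClosed K] [NeZero (2 : K)] [AddCommGroup V] [Module K V] [FiniteDimensional K V]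
    {f : ι → End K V} (hinj : Function.Injective f) (hcomm : ∀ i j, Commute (f i) (f j))
    (hsq : ∀ i, f i ^ 2 = 1) : Nat.card ι ≤ 2 ^ finrank K V := by
  classical
  have heig (i : ι) (μ : K) : (f i).maxGenEigenspace μ = (f i).eigenspace μ :=
    (isSemisimple_of_sq_eq_one (hsq i)).isFinitelySemisimple.maxGenEigenspace_eq_eigenspace μ
  have hind : iSupIndep fun χ : ι → K ↦ ⨅ i, (f i).eigenspace (χ i) := by
    simpa only [heig] using independent_iInf_maxGenEigenspace_of_forall_mapsTo f
      fun i j ↦ mapsTo_maxGenEigenspace_of_comm (hcomm j i)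
  have htop : ⨆ χ : ι → K, ⨅ i, (f i).eigenspace (χ i) = ⊤ := by
    simpa only [heig] using
      iSup_iInf_maxGenEigenspace_eq_top_of_iSup_maxGenEigenspace_eq_top_of_commute f
        (fun i j _ ↦ hcomm i j) fun i ↦ iSup_maxGenEigenspace_eq_top (f i)
  let S := {χ : ι → K // ⨅ i, (f i).eigenspace (χ i) ≠ ⊥}
  let : Fintype S := hind.fintypeNeBotOfFiniteDimensional
  have hval {χ : ι → K} {i : ι} {v : V} (hv : v ≠ 0) (h : f i v = χ i • v) :
      χ i = 1 ∨ χ i = -1 := by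
    have hsmul : (χ i ^ 2) • v = (1 : K) • v := by
      simpa [sq, h, smul_smul] using LinearMap.congr_fun (hsq i) v
    exact sq_eq_one_iff.1 (smul_left_injective K hv hsmul)
  have hsign : Function.Injective fun (i : ι) (χ : S) ↦ decide (χ.1 i = 1) := by
    intro i j hij
    refine hinj (sub_eq_zero.1 (LinearMap.ker_eq_top.1 (top_le_iff.1 ?_)))
    rw [← htop]
    refine iSup_le fun χ v hv ↦ ?_
    by_cases hv0 : v = 0
    · simp [hv0]
    have hmem (l : ι) : f l v = χ l • v := mem_eigenspace_iff.1 ((Submodule.mem_iInf _).1 hv l)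
    have hχ := congr_fun hij ⟨χ, fun h ↦ hv0 (by simpa [h] using hv)⟩
    have : χ i = χ j := by
      rcases hval hv0 (hmem i) with h₁ | h₁ <;> rcases hval hv0 (hmem j) with h₂ | h₂ <;>
        simp_all
    simp [hmem, this]
  calc
    Nat.card ι ≤ Nat.card (S → Bool) := Nat.card_le_card_of_injective _ hsign
    _ = 2 ^ Fintype.card S := by simp
    _ ≤ 2 ^ finrank K V := Nat.pow_le_pow_right two_pos hind.subtype_ne_bot_le_finrank

/-- If `(ℤ/2ℤ)^k` embeds in `GL n ℂ`, then `k ≤ n`. -/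
theorem le_of_elementary_abelian_embeds_glnc (n k : ℕ)
    (f : Multiplicative (Fin k → ZMod 2) →* GL (Fin n) ℂ)
    (hf : Function.Injective f) : k ≤ n := by
  let ρ : Multiplicative (Fin k → ZMod 2) →* Module.End ℂ (Fin n → ℂ) :=
    (Matrix.toLinAlgEquiv' : _ ≃ₐ[ℂ] Module.End ℂ (Fin n → ℂ)).toMonoidHom.comp
      ((Units.coeHom _).comp f)
  have hρ : Function.Injective ρ :=
    Matrix.toLinAlgEquiv'.injective.comp (Units.val_injective.comp hf)
  have hsq (g : Multiplicative (Fin k → ZMod 2)) : g ^ 2 = 1 :=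
    Multiplicative.toAdd.injective (funext fun i ↦ by simp [CharTwo.two_eq_zero])
  have := Module.End.card_le_two_pow_finrank_of_commute_of_sq_eq_one hρ
    (fun g h ↦ (Commute.all g h).map ρ) fun g ↦ by rw [← map_pow, hsq, map_one]
  simpa [Nat.pow_le_pow_iff_right] using this
end
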